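/- arXiv:1303.4109 — 3 statements merged into one kernel-verified Lean document; each statement's English description precedes it below -/
import Mathlib

section
/- Let v > 0, C ≥ 1, r_1 ≥ 0, and let F : (0,∞) → (0,∞) be a nondecreasing function satisfying C^{-1} e^{v r} ≤ F(r) ≤ C e^{v r} for all r ≥ r_1. Then for every ε_0 > 0 there exists a function ε : (0,∞) → [0, ε_0) such that lim_{δ→0+} limsup_{r→∞} F(r + ε(r) + δ) / F(r + ε(r)) = 1 and lim_{δ→0+} liminf_{r→∞} F(r + ε(r) − δ) / F(r + ε(r)) = 1. -/
open Filter

/-- The left endpoints of nested intervals of lengths `L / 4 ^ n`: each interval is the middle half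
of that half of its predecessor on which `G` increases less. -/
noncomputable def nestedLeft (G : ℝ → ℝ) (a L : ℝ) : ℕ → ℝ
  | 0 => a
  | n + 1 =>
    let x := nestedLeft G a L n
    let l := L / 4 ^ n
    if G (x + l / 2) - G x ≤ (G (x + l) - G x) / 2 then x + l / 8 else x + 5 * l / 8

lemma nestedLeft_succ_mem (G : ℝ → ℝ) (a : ℝ) {L : ℝ} (hL : 0 < L) (n : ℕ) :
    nestedLeft G a L n + L / 4 ^ n / 8 ≤ nestedLeft G a L (n + 1) ∧
      nestedLeft G a L (n + 1) + L / 4 ^ (n + 1) ≤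
        nestedLeft G a L n + L / 4 ^ n - L / 4 ^ n / 8 := by
  have hl : 0 < L / 4 ^ n := by positivity
  have hs : L / 4 ^ (n + 1) = L / 4 ^ n / 4 := by rw [pow_succ, div_div]
  rw [hs, nestedLeft]
  split_ifs <;> constructor <;> linarith

lemma nestedLeft_bounds (G : ℝ → ℝ) (a : ℝ) {L : ℝ} (hL : 0 < L) (n : ℕ) :
    a ≤ nestedLeft G a L n ∧ nestedLeft G a L n + L / 4 ^ n ≤ a + L := by
  induction n with
  | zero => simp [nestedLeft]
  | succ n ih =>
    have hl : 0 < L / 4 ^ n := by positivity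
    have h := nestedLeft_succ_mem G a hL n
    constructor <;> linarith [h.1, h.2, ih.1, ih.2]

lemma nestedLeft_increment_le {G : ℝ → ℝ} {a L : ℝ} (hL : 0 < L)
    (hG : MonotoneOn G (Set.Icc a (a + L))) (n : ℕ) :
    G (nestedLeft G a L n + L / 4 ^ n) - G (nestedLeft G a L n) ≤ (G (a + L) - G a) / 2 ^ n := by
  induction n with
  | zero => simp [nestedLeft]
  | succ n ih =>
    have hl : 0 < L / 4 ^ n := by positivity
    have hs : L / 4 ^ (n + 1) = L / 4 ^ n / 4 := by rw [pow_succ, div_div]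
    obtain ⟨h1, h2⟩ := nestedLeft_bounds G a hL n
    rw [hs, pow_succ, ← div_div, nestedLeft]
    generalize nestedLeft G a L n = x at *
    generalize L / 4 ^ n = l at *
    have mono : ∀ y z, x ≤ y → y ≤ z → z ≤ x + l → G y ≤ G z := fun y z hy hyz hz =>
      hG ⟨by linarith, by linarith⟩ ⟨by linarith, by linarith⟩ hyz
    split_ifs with h
    · have := mono x (x + l / 8) (by linarith) (by linarith) (by linarith)
      have := mono (x + l / 8 + l / 4) (x + l / 2) (by linarith) (by linarith) (by linarith)
      linarith
    · have := mono (x + l / 2) (x + 5 * l / 8) (by linarith) (by linarith) (by linarith)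
      have := mono (x + 5 * l / 8 + l / 4) (x + l) (by linarith) (by linarith) (by linarith)
      linarith

/-- A monotone function on an interval has a point of continuity, with a modulus of continuity
depending only on the length of the interval and the total increment of the function. -/
lemma MonotoneOn.exists_uniform_modulus {G : ℝ → ℝ} {a L : ℝ} (hL : 0 < L)
    (hG : MonotoneOn G (Set.Icc a (a + L))) :
    ∃ t ∈ Set.Icc a (a + L), ∀ (n : ℕ) (δ : ℝ), 0 ≤ δ → δ ≤ L / 4 ^ n / 8 →
      a ≤ t - δ ∧ t + δ ≤ a + L ∧ G (t + δ) - G (t - δ) ≤ (G (a + L) - G a) / 2 ^ n := by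
  have hanti : Antitone fun n =>
      Set.Icc (nestedLeft G a L n) (nestedLeft G a L n + L / 4 ^ n) := by
    refine antitone_nat_of_succ_le fun n => ?_
    have hl : 0 < L / 4 ^ n := by positivity
    have h := nestedLeft_succ_mem G a hL n
    exact Set.Icc_subset_Icc (by linarith [h.1]) (by linarith [h.2])
  have hmem := ciSup_mem_iInter_Icc_of_antitone_Icc hanti
    fun n => le_add_of_nonneg_right (by positivity)
  generalize (⨆ n, nestedLeft G a L n) = t at hmem
  rw [Set.mem_iInter] at hmem
  refine ⟨t, by simpa [nestedLeft] using hmem 0, fun n δ hδ hδn => ?_⟩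
  have h := nestedLeft_succ_mem G a hL n
  have hb := nestedLeft_bounds G a hL n
  have ht := hmem (n + 1)
  have hinc := nestedLeft_increment_le hL hG n
  have hlo : nestedLeft G a L n ≤ t - δ := by linarith [h.1, ht.1]
  have hhi : t + δ ≤ nestedLeft G a L n + L / 4 ^ n := by linarith [h.2, ht.2]
  have g1 : G (nestedLeft G a L n) ≤ G (t - δ) :=
    hG ⟨hb.1, by linarith⟩ ⟨by linarith, by linarith⟩ hlo
  have g2 : G (t + δ) ≤ G (nestedLeft G a L n + L / 4 ^ n) :=
    hG ⟨by linarith, by linarith⟩ ⟨by linarith, hb.2⟩ hhi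
  exact ⟨by linarith, by linarith, by linarith⟩

lemma limsup_mem_Icc_of_eventually {α : Type*} {l : Filter α} [l.NeBot] {f : α → ℝ} {a b : ℝ}
    (h : ∀ᶠ x in l, f x ∈ Set.Icc a b) : limsup f l ∈ Set.Icc a b := by
  have ha : ∀ᶠ x in l, a ≤ f x := h.mono fun _ hx => hx.1
  have hb : ∀ᶠ x in l, f x ≤ b := h.mono fun _ hx => hx.2
  exact ⟨le_limsup_of_frequently_le ha.frequently (isBoundedUnder_of_eventually_le hb),
    limsup_le_of_le (isCoboundedUnder_le_of_eventually_le l ha) hb⟩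

lemma liminf_mem_Icc_of_eventually {α : Type*} {l : Filter α} [l.NeBot] {f : α → ℝ} {a b : ℝ}
    (h : ∀ᶠ x in l, f x ∈ Set.Icc a b) : liminf f l ∈ Set.Icc a b := by
  have ha : ∀ᶠ x in l, a ≤ f x := h.mono fun _ hx => hx.1
  have hb : ∀ᶠ x in l, f x ≤ b := h.mono fun _ hx => hx.2
  exact ⟨le_liminf_of_le (isCoboundedUnder_ge_of_eventually_le l hb) ha,
    liminf_le_of_frequently_le hb.frequently (isBoundedUnder_of_eventually_ge ha)⟩

lemma tendsto_one_of_eventually_mem_Icc_exp {α : Type*} {l : Filter α} {f : α → ℝ} (M : ℝ)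
    (h : ∀ n : ℕ, ∀ᶠ x in l, f x ∈ Set.Icc (Real.exp (-(M / 2 ^ n))) (Real.exp (M / 2 ^ n))) :
    Tendsto f l (nhds 1) := by
  have h0 : Tendsto (fun n : ℕ => M / 2 ^ n) atTop (nhds 0) :=
    tendsto_const_nhds.div_atTop (tendsto_pow_atTop_atTop_of_one_lt one_lt_two)
  have hu : Tendsto (fun n : ℕ => Real.exp (M / 2 ^ n)) atTop (nhds 1) := by
    simpa [Function.comp_def] using (Real.continuous_exp.tendsto 0).comp h0
  have hd : Tendsto (fun n : ℕ => Real.exp (-(M / 2 ^ n))) atTop (nhds 1) := by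
    simpa [Function.comp_def] using (Real.continuous_exp.tendsto (-0)).comp h0.neg
  refine tendsto_order.2 ⟨fun a ha => ?_, fun a ha => ?_⟩
  · obtain ⟨n, hn⟩ := (hd.eventually_const_lt ha).exists
    exact (h n).mono fun x hx => hn.trans_le hx.1
  · obtain ⟨n, hn⟩ := (hu.eventually_lt_const ha).exists
    exact (h n).mono fun x hx => hx.2.trans_lt hn

lemma div_mem_Icc_exp_of_abs_log_sub_le {x y c : ℝ} (hx : 0 < x) (hy : 0 < y)
    (h : |Real.log x - Real.log y| ≤ c) :
    x / y ∈ Set.Icc (Real.exp (-c)) (Real.exp c) := by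
  rw [← Real.log_div hx.ne' hy.ne', abs_le] at h
  have hxy : 0 < x / y := div_pos hx hy
  exact ⟨(Real.le_log_iff_exp_le hxy).1 h.1, (Real.log_le_iff_le_exp hxy).1 h.2⟩

theorem stmt_17
    (v C r₁ : ℝ) (hv : 0 < v) (hC : 1 ≤ C) (hr₁ : 0 ≤ r₁)
    (F : ℝ → ℝ)
    (hFpos : ∀ r : ℝ, 0 < r → 0 < F r)
    (hFmono : ∀ r s : ℝ, 0 < r → r ≤ s → F r ≤ F s)
    (hFbound : ∀ r : ℝ, 0 < r → r₁ ≤ r →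
      C⁻¹ * Real.exp (v * r) ≤ F r ∧ F r ≤ C * Real.exp (v * r)) :
    ∀ ε₀ : ℝ, 0 < ε₀ → ∃ ε : ℝ → ℝ, (∀ r : ℝ, 0 ≤ ε r ∧ ε r < ε₀) ∧
      Tendsto (fun δ : ℝ => limsup (fun r : ℝ => F (r + ε r + δ) / F (r + ε r)) atTop)
        (nhdsWithin 0 (Set.Ioi 0)) (nhds 1) ∧
      Tendsto (fun δ : ℝ => liminf (fun r : ℝ => F (r + ε r - δ) / F (r + ε r)) atTop)
        (nhdsWithin 0 (Set.Ioi 0)) (nhds 1) := by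
  intro ε₀ hε₀
  set L := ε₀ / 2
  have hL : 0 < L := by positivity
  have hLε : L < ε₀ := half_lt_self hε₀
  set M := 2 * Real.log C + v * L
  have hC0 : 0 < C := by linarith
  have logMono : ∀ x y, 0 < x → x ≤ y → Real.log (F x) ≤ Real.log (F y) := fun x y hx hxy =>
    Real.log_le_log (hFpos x hx) (hFmono x y hx hxy)
  have increment : ∀ r, 0 < r → r₁ ≤ r → Real.log (F (r + L)) - Real.log (F r) ≤ M := by
    intro r hr hr'
    have hlo := Real.log_le_log (by positivity) (hFbound r hr hr').1
    have hhi := Real.log_le_log (hFpos (r + L) (by linarith))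
      (hFbound (r + L) (by linarith) (by linarith)).2
    rw [Real.log_mul (by positivity) (Real.exp_pos _).ne', Real.log_exp] at hlo hhi
    rw [Real.log_inv] at hlo
    linarith
  have key : ∀ r : ℝ, ∃ e : ℝ, (0 ≤ e ∧ e < ε₀) ∧ (0 < r → r₁ ≤ r →
      ∀ (n : ℕ) (δ : ℝ), 0 ≤ δ → δ ≤ L / 4 ^ n / 8 → 0 < r + e - δ ∧
        Real.log (F (r + e + δ)) - Real.log (F (r + e - δ)) ≤ M / 2 ^ n) := by
    intro r
    by_cases hr : 0 < r ∧ r₁ ≤ r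
    · obtain ⟨t, ht, hmod⟩ := MonotoneOn.exists_uniform_modulus (G := fun x => Real.log (F x))
        (a := r) hL fun x hx y _ hxy => logMono x y (hr.1.trans_le hx.1) hxy
      refine ⟨t - r, ⟨by linarith [ht.1], by linarith [ht.2, hLε]⟩, fun _ _ n δ hδ hδn => ?_⟩
      obtain ⟨h1, -, h3⟩ := hmod n δ hδ hδn
      rw [add_sub_cancel]
      exact ⟨by linarith [hr.1], h3.trans (by gcongr; exact increment r hr.1 hr.2)⟩
    · exact ⟨0, ⟨le_rfl, hε₀⟩, fun h h' => absurd ⟨h, h'⟩ hr⟩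
  choose ε hε hmod using key
  have small : ∀ n : ℕ, ∀ᶠ δ in nhdsWithin (0 : ℝ) (Set.Ioi 0), 0 < δ ∧ δ ≤ L / 4 ^ n / 8 :=
    fun n => (Ioc_mem_nhdsGT (by positivity) :
      Set.Ioc 0 (L / 4 ^ n / 8) ∈ nhdsWithin (0 : ℝ) (Set.Ioi 0))
  refine ⟨ε, hε, tendsto_one_of_eventually_mem_Icc_exp M fun n => ?_,
    tendsto_one_of_eventually_mem_Icc_exp M fun n => ?_⟩
  · filter_upwards [small n] with δ hδ
    apply limsup_mem_Icc_of_eventually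
    filter_upwards [eventually_gt_atTop 0, eventually_ge_atTop r₁] with r h0 h1
    obtain ⟨hpos, hle⟩ := hmod r h0 h1 n δ hδ.1.le hδ.2
    have m1 := logMono (r + ε r - δ) (r + ε r) hpos (by linarith)
    have m2 := logMono (r + ε r) (r + ε r + δ) (by linarith) (by linarith)
    exact div_mem_Icc_exp_of_abs_log_sub_le (hFpos _ (by linarith)) (hFpos _ (by linarith))
      (abs_le.2 ⟨by linarith, by linarith⟩)
  · filter_upwards [small n] with δ hδ
    apply liminf_mem_Icc_of_eventually
    filter_upwards [eventually_gt_atTop 0, eventually_ge_atTop r₁] with r h0 h1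
    obtain ⟨hpos, hle⟩ := hmod r h0 h1 n δ hδ.1.le hδ.2
    have m1 := logMono (r + ε r - δ) (r + ε r) hpos (by linarith)
    have m2 := logMono (r + ε r) (r + ε r + δ) (by linarith) (by linarith)
    exact div_mem_Icc_exp_of_abs_log_sub_le (hFpos _ (by linarith)) (hFpos _ (by linarith))
      (abs_le.2 ⟨by linarith, by linarith⟩)
end

section
/- Let Γ be an infinite non-elementary word hyperbolic group with finite symmetric generating set S and word length |·|_S. Then there exist constants v > 0 and C > 0 such that for every integer n ≥ 0, C^{-1} e^{v n} ≤ |{g ∈ Γ : |g|_S = n}| ≤ C e^{v n}. -/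
/-- The word length of `g` with respect to a generating set `S`. -/
noncomputable def wordLength {Γ : Type} [Group Γ] (S : Set Γ) (g : Γ) : ℕ :=
  sInf {n : ℕ | ∃ l : List Γ, (∀ x ∈ l, x ∈ S) ∧ l.length = n ∧ l.prod = g}

/-- A length function on a group that behaves like the word length of a hyperbolic group: balls are
finite, geodesics exist, and the four-point condition holds with constant `D`. -/
structure IsHyperbolicLength {Γ : Type} [Group Γ] (ℓ : Γ → ℕ) (D : ℕ) : Prop where
  one : ℓ 1 = 0
  eq_one : ∀ g, ℓ g = 0 → g = 1
  inv : ∀ g, ℓ g⁻¹ = ℓ g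
  mul_le : ∀ g h, ℓ (g * h) ≤ ℓ g + ℓ h
  finite_ball : ∀ n, Finite {g // ℓ g ≤ n}
  exists_geodesic : ∀ g, ∃ p : ℕ → Γ, p 0 = 1 ∧ p (ℓ g) = g ∧
    ∀ i j, i ≤ j → j ≤ ℓ g → ℓ ((p i)⁻¹ * p j) = j - i
  four_point : ∀ x y z w, ℓ (x⁻¹ * y) + ℓ (z⁻¹ * w) ≤
    max (ℓ (x⁻¹ * z) + ℓ (y⁻¹ * w)) (ℓ (y⁻¹ * z) + ℓ (x⁻¹ * w)) + D

namespace IsHyperbolicLength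

variable {Γ : Type} [Group Γ] {ℓ : Γ → ℕ} {D : ℕ}

theorem dist_comm (h : IsHyperbolicLength ℓ D) (x y : Γ) : ℓ (x⁻¹ * y) = ℓ (y⁻¹ * x) := by
  rw [← h.inv, mul_inv_rev, inv_inv]

/-- Approximate transitivity of a lower bound `(t - e) / 2` on Gromov products based at `1`. -/
theorem gromov_trans (h : IsHyperbolicLength ℓ D) {x y z : Γ} {t e : ℕ}
    (hxz : t + ℓ (x⁻¹ * z) ≤ ℓ x + ℓ z + e) (hzy : t + ℓ (z⁻¹ * y) ≤ ℓ z + ℓ y + e) :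
    t + ℓ (x⁻¹ * y) ≤ ℓ x + ℓ y + (e + D) := by
  have h4 := h.four_point x y z 1
  simp only [mul_one, h.inv] at h4
  rw [h.dist_comm y z] at h4
  omega

theorem le_add_dist (h : IsHyperbolicLength ℓ D) (x y : Γ) : ℓ y ≤ ℓ x + ℓ (x⁻¹ * y) := by
  simpa using h.mul_le x (x⁻¹ * y)

/-- A point at distance `i` from `1` on a geodesic from `1` to `g`. -/
theorem exists_point_on_geodesic (h : IsHyperbolicLength ℓ D) (g : Γ) {i : ℕ} (hi : i ≤ ℓ g) :
    ∃ a, ℓ a = i ∧ ℓ (a⁻¹ * g) = ℓ g - i := by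
  obtain ⟨p, h0, h1, hp⟩ := h.exists_geodesic g
  refine ⟨p i, ?_, ?_⟩
  · simpa [h0] using hp 0 i (Nat.zero_le _) hi
  · simpa [h1] using hp i (ℓ g) hi le_rfl

theorem exists_length_ge (h : IsHyperbolicLength ℓ D) [Infinite Γ] (n : ℕ) : ∃ g, n ≤ ℓ g := by
  by_contra! hc
  have := h.finite_ball n
  exact not_finite_iff_infinite.2 ‹Infinite Γ› <|
    Finite.of_injective (fun g : Γ => (⟨g, (hc g).le⟩ : {g // ℓ g ≤ n}))
      fun a b hab => by simpa using hab

theorem finite_sphere (h : IsHyperbolicLength ℓ D) (n : ℕ) : Finite {g // ℓ g = n} := by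
  have := h.finite_ball n
  exact Finite.of_injective (fun g => (⟨g.1, g.2.le⟩ : {g // ℓ g ≤ n}))
    fun a b hab => Subtype.ext (by simpa using hab)

theorem card_sphere_pos (h : IsHyperbolicLength ℓ D) [Infinite Γ] (n : ℕ) :
    0 < Nat.card {g // ℓ g = n} := by
  have := h.finite_sphere n
  obtain ⟨g, hg⟩ := h.exists_length_ge n
  obtain ⟨a, ha, -⟩ := h.exists_point_on_geodesic g hg
  have : Nonempty {g // ℓ g = n} := ⟨⟨a, ha⟩⟩
  exact Nat.card_pos

/-- The cone type of an element is determined by which nearby elements are strictly shorter. -/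
theorem cone_subset (h : IsHyperbolicLength ℓ D) {g g' : Γ}
    (hg : ∀ v, ℓ v ≤ 2 * D + 1 → ℓ (g' * v) < ℓ g' → ℓ (g * v) < ℓ g) (w : Γ)
    (hw : ℓ (g * w) = ℓ g + ℓ w) : ℓ (g' * w) = ℓ g' + ℓ w := by
  induction hn : ℓ w generalizing w with
  | zero => simp [h.eq_one w hn]
  | succ n ih =>
    obtain ⟨u, hu, hus⟩ := h.exists_point_on_geodesic w (i := n) (by omega)
    have hgu : ℓ (g * u) = ℓ g + ℓ u := by
      have h1 := h.mul_le (g * u) (u⁻¹ * w)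
      have h2 := h.mul_le g u
      rw [mul_assoc, mul_inv_cancel_left] at h1
      omega
    have hu' := ih u hgu hu
    refine le_antisymm (hn ▸ h.mul_le g' w) ?_
    by_contra! hlt
    have hdist : ℓ ((g' * u)⁻¹ * (g' * w)) = 1 := by
      rw [mul_inv_rev, mul_assoc, inv_mul_cancel_left]; omega
    have hlow := h.le_add_dist (g' * w) (g' * u)
    rw [h.dist_comm, hdist] at hlow
    rcases Nat.eq_zero_or_pos (ℓ g') with h0 | hpos
    · rw [h.eq_one g' h0, one_mul, h.one] at hlt
      omega
    obtain ⟨a, ha, haw⟩ := h.exists_point_on_geodesic (g' * w) (i := ℓ g' - 1) (by omega)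
    have hgd : ℓ (g'⁻¹ * (g' * u)) = n := by rw [inv_mul_cancel_left, hu]
    have s1 := h.gromov_trans (x := g') (y := g' * w) (z := g' * u) (t := 2 * (ℓ g' - 1)) (e := 0)
      (by omega) (by omega)
    have s2 := h.gromov_trans (x := g') (y := a) (z := g' * w) (t := 2 * (ℓ g' - 1)) (e := 0 + D)
      s1 (by rw [h.dist_comm]; omega)
    have s3 := hg (g'⁻¹ * a) (by omega) (by rw [mul_inv_cancel_left]; omega)
    have s4 := h.mul_le (g * (g'⁻¹ * a)) (a⁻¹ * (g' * w))
    have s5 : g * (g'⁻¹ * a) * (a⁻¹ * (g' * w)) = g * w := by group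
    rw [s5] at s4
    omega

theorem exists_length_pow (h : IsHyperbolicLength ℓ D) [Infinite Γ] :
    ∃ b : Γ, 0 < ℓ b ∧ ∀ n, ℓ (b ^ n) = n * ℓ b := by
  have := h.finite_ball (2 * D + 1)
  let T : Γ → Set {g // ℓ g ≤ 2 * D + 1} := fun g => {v | ℓ (g * v) < ℓ g}
  obtain ⟨g, hg⟩ := h.exists_length_ge (Nat.card (Set {g // ℓ g ≤ 2 * D + 1}))
  obtain ⟨p, hp0, hp1, hp⟩ := h.exists_geodesic g
  have hninj : ¬ Function.Injective fun i : Fin (ℓ g + 1) => T (p i) := fun hinj => by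
    have := Nat.card_le_card_of_injective _ hinj
    rw [Nat.card_fin] at this
    omega
  obtain ⟨i, j, hij, hlt⟩ : ∃ i j : Fin (ℓ g + 1), T (p i) = T (p j) ∧ i < j := by
    simp only [Function.Injective, not_forall] at hninj
    obtain ⟨i, j, hij, hne⟩ := hninj
    rcases lt_or_gt_of_ne hne with hl | hl
    · exact ⟨i, j, hij, hl⟩
    · exact ⟨j, i, hij.symm, hl⟩
  have hlen : ∀ k : Fin (ℓ g + 1), ℓ (p k) = k := fun k => by
    simpa [hp0] using hp 0 k (Nat.zero_le _) (Nat.lt_succ_iff.1 k.2)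
  have hlt' : (i : ℕ) < j := hlt
  have hb := hp i j hlt'.le (Nat.lt_succ_iff.1 j.2)
  have hcone := h.cone_subset (g := p i) (g' := p j) fun v hv hlt => by
    have : (⟨v, hv⟩ : {g // ℓ g ≤ 2 * D + 1}) ∈ T (p i) := by rw [hij]; exact hlt
    exact this
  set b := (p i)⁻¹ * p j with hbdef
  have hpj : p j = p i * b := by simp [hbdef]
  refine ⟨b, by omega, fun n => ?_⟩
  suffices ℓ (b ^ n) = n * ℓ b ∧ ℓ (p i * b ^ n) = ℓ (p i) + ℓ (b ^ n) from this.1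
  induction n with
  | zero => simp [h.one]
  | succ n ih =>
    have h1 := hcone _ ih.2
    rw [hpj, mul_assoc, ← pow_succ', ← hpj, hlen, ih.1] at h1
    have h2 := h.mul_le (p i) (b ^ (n + 1))
    have h3 := h.mul_le (b ^ n) b
    rw [← pow_succ] at h3
    have h4 := hlen i
    have h5 : (n + 1) * ℓ b = n * ℓ b + ℓ b := by ring
    omega

/-- In a group of linear growth, any infinite cyclic subgroup has finite index. -/
theorem finiteIndex_zpowers (h : IsHyperbolicLength ℓ D) {b : Γ}
    (hb : Function.Injective fun n : ℕ => b ^ n) {C : ℕ}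
    (hC : ∀ n, Nat.card {g // ℓ g ≤ n} ≤ C * (n + 1)) : (Subgroup.zpowers b).FiniteIndex := by
  by_contra hfin
  set H := Subgroup.zpowers b
  set N := C * (1 + ℓ b) with hN
  obtain ⟨x, hx⟩ : ∃ x, ∀ k ∈ H, N ≤ ℓ (x * k) := by
    by_contra! hc
    have := h.finite_ball N
    have : Finite (Γ ⧸ H) := by
      refine Finite.of_surjective (fun g : {g // ℓ g ≤ N} => (g.1 : Γ ⧸ H)) fun q => ?_
      obtain ⟨x, rfl⟩ := QuotientGroup.mk_surjective q
      obtain ⟨k, hk, hlt⟩ := hc x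
      exact ⟨⟨x * k, hlt.le⟩, QuotientGroup.mk_mul_of_mem x hk⟩
    exact hfin Subgroup.finiteIndex_of_finite_quotient
  obtain ⟨y, hyN, hy⟩ : ∃ y, N ≤ ℓ y ∧ ∀ k ∈ H, ℓ y ≤ ℓ (y * k) := by
    obtain ⟨k, hk, hmin⟩ := exists_minimalFor_of_wellFoundedLT (· ∈ H) (fun k => ℓ (x * k))
      ⟨1, H.one_mem⟩
    refine ⟨x * k, hx k hk, fun k' hk' => ?_⟩
    by_contra! hlt
    rw [mul_assoc] at hlt
    exact absurd (hmin (H.mul_mem hk hk') hlt.le) (not_le.2 hlt)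
  have hxi : ∀ i : Fin (N + 1), ∃ x, ℓ x = i ∧ ∀ k ∈ H, ℓ x ≤ ℓ (x * k) := fun i => by
    obtain ⟨a, ha, hay⟩ := h.exists_point_on_geodesic y (i := ℓ y - i) (Nat.sub_le _ _)
    have hi := i.2
    refine ⟨a⁻¹ * y, by omega, fun k hk => ?_⟩
    have h1 := hy k hk
    have h2 := h.mul_le a (a⁻¹ * y * k)
    rw [mul_assoc a⁻¹, mul_inv_cancel_left, ← mul_assoc] at h2
    omega
  choose z hz hzmin using hxi
  have hpow : ∀ n, ℓ (b ^ n) ≤ n * ℓ b := fun n => by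
    induction n with
    | zero => simp [h.one]
    | succ n ih =>
      rw [pow_succ, add_one_mul]
      exact (h.mul_le _ _).trans (Nat.add_le_add_right ih _)
  have := h.finite_ball (N * (1 + ℓ b))
  have hcard := Nat.card_le_card_of_injective
    (fun q : Fin (N + 1) × Fin (N + 1) => (⟨z q.1 * b ^ (q.2 : ℕ), by
      have h1 := h.mul_le (z q.1) (b ^ (q.2 : ℕ))
      have h2 := hpow q.2
      have h3 : (q.2 : ℕ) * ℓ b ≤ N * ℓ b := Nat.mul_le_mul_right _ (Nat.lt_succ_iff.1 q.2.2)
      have h4 := hz q.1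
      have h5 := q.1.2
      rw [mul_add, mul_one]
      omega⟩ : {g // ℓ g ≤ N * (1 + ℓ b)})) (by
    rintro ⟨i, m⟩ ⟨i', m'⟩ heq
    have heq : z i * b ^ (m : ℕ) = z i' * b ^ (m' : ℕ) := congrArg Subtype.val heq
    have hm : ∀ n : ℕ, b ^ n ∈ H := fun n => H.pow_mem (Subgroup.mem_zpowers b) n
    have h1 : z i * (b ^ (m : ℕ) * (b ^ (m' : ℕ))⁻¹) = z i' := by
      rw [← mul_assoc, heq, mul_inv_cancel_right]
    have h2 : z i' * (b ^ (m' : ℕ) * (b ^ (m : ℕ))⁻¹) = z i := by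
      rw [← mul_assoc, ← heq, mul_inv_cancel_right]
    have h3 := hzmin i _ (H.mul_mem (hm m) (H.inv_mem (hm m')))
    have h4 := hzmin i' _ (H.mul_mem (hm m') (H.inv_mem (hm m)))
    rw [h1, hz, hz] at h3
    rw [h2, hz, hz] at h4
    obtain rfl : i = i' := Fin.ext (le_antisymm h3 h4)
    have h5 : (m : ℕ) = m' := hb (mul_left_cancel heq)
    simp [Fin.ext h5])
  rw [Nat.card_prod, Nat.card_fin] at hcard
  have hle := hcard.trans (hC _)
  have : C * (N * (1 + ℓ b) + 1) ≤ N * N + C := by rw [hN]; apply le_of_eq; ring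
  have : C ≤ N := by rw [hN]; exact Nat.le_mul_of_pos_right _ (by omega)
  nlinarith

/-- The ball of radius `R` has size at most linear in `R` if some pair `g`, `k` has large cancellation
in all products `g * f * k` with `f` in that ball. -/
theorem card_ball_le_of_cancellation (h : IsHyperbolicLength ℓ D) {R : ℕ} {g k : Γ}
    (hgk : ∀ f, ℓ f ≤ R → ℓ (g * f * k) + (7 * R + 5 * D + 2) < ℓ g + ℓ k) :
    Nat.card {f // ℓ f ≤ R} ≤ (2 * R + D + 2) * Nat.card {f // ℓ f ≤ 3 * D} := by
  have hg1 : ∀ f, ℓ f ≤ R → 2 * (3 * R + 2 * D + 1) + ℓ ((f * k)⁻¹ * g⁻¹) ≤ ℓ (f * k) + ℓ g⁻¹ := by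
    intro f hf
    have h1 := hgk f hf
    have h2 := h.le_add_dist f⁻¹ k
    rw [h.inv, inv_inv] at h2
    rw [h.dist_comm, inv_inv, ← mul_assoc, h.inv]
    omega
  have hfk : ∀ f, ℓ f ≤ R → 2 * (3 * R + 2 * D + 1) + ℓ ((f * k)⁻¹ * k) ≤ ℓ (f * k) + ℓ k + D := by
    intro f hf
    have h1 := hg1 f hf
    have h2 := hg1 1 (by simp [h.one])
    rw [one_mul] at h2
    rw [h.dist_comm] at h2
    have := h.gromov_trans (y := k) (e := 0) h1 (by omega)
    omega
  have hk : 3 * R + 2 * D + 1 ≤ ℓ k := by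
    have h1 := hgk 1 (by simp [h.one])
    have h2 := h.le_add_dist g⁻¹ k
    have h3 := h.le_add_dist (g * k) g
    have h4 : ℓ ((g * k)⁻¹ * g) = ℓ k := by rw [h.dist_comm]; simp
    rw [mul_one] at h1
    omega
  obtain ⟨p, hp0, hp1, hp⟩ := h.exists_geodesic k
  set i := R + D + 1 with hi
  have hpl : ∀ j, j ≤ ℓ k → ℓ (p j) = j := fun j hj => by
    simpa [hp0] using hp 0 j (Nat.zero_le _) hj
  have hpk : ∀ j, j ≤ ℓ k → ℓ ((p j)⁻¹ * k) = ℓ k - j := fun j hj => by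
    simpa [hp1] using hp j (ℓ k) hj le_rfl
  have hik := hpk i (by omega)
  have hil := hpl i (by omega)
  have hj : ∀ f, ℓ f ≤ R → ℓ (f * p i) < 2 * R + D + 2 := fun f hf => by
    have := h.mul_le f (p i); omega
  have hclose : ∀ f, ℓ f ≤ R → ℓ ((p (ℓ (f * p i)))⁻¹ * (f * p i)) ≤ 3 * D := by
    intro f hf
    have hj' := hj f hf
    have e1 : ℓ ((f * p i)⁻¹ * (f * k)) = ℓ k - i := by
      rw [mul_inv_rev, mul_assoc, inv_mul_cancel_left, hik]
    have h4 := h.four_point 1 (f * p i) f (f * k)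
    have e2 : (f * p i)⁻¹ * f = (p i)⁻¹ := by group
    rw [e1, e2, h.inv, hil] at h4
    simp only [inv_one, one_mul, inv_mul_cancel_left] at h4
    have h5 := h.le_add_dist f⁻¹ (p i)
    rw [h.inv, inv_inv] at h5
    have hon : ℓ (f * p i) + (ℓ k - i) ≤ ℓ (f * k) + D := by omega
    by_cases hjk : ℓ (f * p i) ≤ ℓ k
    · have s1 := h.gromov_trans (x := f * p i) (z := f * k) (y := k) (t := 2 * ℓ (f * p i))
        (e := D) (by omega) (by have := hfk f hf; omega)
      have e3 := hpk _ hjk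
      have e4 := hpl _ hjk
      have s2 := h.gromov_trans (x := f * p i) (z := k) (y := p (ℓ (f * p i)))
        (t := 2 * ℓ (f * p i)) (e := D + D) s1 (by rw [h.dist_comm]; omega)
      rw [h.dist_comm]
      omega
    · omega
  have := h.finite_ball (3 * D)
  rw [← Nat.card_fin (2 * R + D + 2), ← Nat.card_prod]
  refine Nat.card_le_card_of_injective
    (fun f : {f // ℓ f ≤ R} => (⟨⟨ℓ (f.1 * p i), hj f.1 f.2⟩, ⟨_, hclose f.1 f.2⟩⟩ :
      Fin (2 * R + D + 2) × {f // ℓ f ≤ 3 * D})) fun a b hab => ?_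
  simp only [Prod.mk.injEq, Fin.mk.injEq, Subtype.mk.injEq] at hab
  obtain ⟨h1, h2⟩ := hab
  rw [h1] at h2
  exact Subtype.ext (mul_right_cancel (mul_left_cancel h2))

theorem card_sphere_add_le (h : IsHyperbolicLength ℓ D) (n m : ℕ) :
    Nat.card {g // ℓ g = n + m} ≤ Nat.card {g // ℓ g = n} * Nat.card {g // ℓ g = m} := by
  have := h.finite_sphere n
  have := h.finite_sphere m
  have hpre : ∀ g : {g // ℓ g = n + m}, ∃ a, ℓ a = n ∧ ℓ (a⁻¹ * g.1) = m := fun g => by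
    obtain ⟨a, ha, hb⟩ := h.exists_point_on_geodesic g.1 (i := n) (by have := g.2; omega)
    exact ⟨a, ha, by have := g.2; omega⟩
  choose a ha hb using hpre
  rw [← Nat.card_prod]
  refine Nat.card_le_card_of_injective
    (fun g => (⟨⟨a g, ha g⟩, ⟨_, hb g⟩⟩ : {g // ℓ g = n} × {g // ℓ g = m})) fun g g' hgg => ?_
  simp only [Prod.mk.injEq, Subtype.mk.injEq] at hgg
  obtain ⟨h1, h2⟩ := hgg
  rw [h1] at h2
  exact Subtype.ext (mul_left_cancel h2)

theorem card_sphere_mul_le (h : IsHyperbolicLength ℓ D) {R K : ℕ}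
    (hRK : ∀ g k, ∃ f, ℓ f ≤ R ∧ ℓ g + ℓ k ≤ ℓ (g * f * k) + K) (n m : ℕ) :
    Nat.card {g // ℓ g = n + K} * Nat.card {g // ℓ g = m + K} ≤
      Nat.card {g // ℓ g = n + m + K} * (Nat.card {g // ℓ g ≤ K + R} *
        (Nat.card {g // ℓ g ≤ R} * Nat.card {g // ℓ g ≤ K + R + D})) := by
  have := h.finite_sphere (n + m + K)
  have := h.finite_ball (K + R)
  have := h.finite_ball R
  have := h.finite_ball (K + R + D)
  choose f hfR hf using hRK
  have hpre : ∀ x, ∃ p : ℕ → Γ, ∀ i ≤ ℓ x, ℓ (p i) = i ∧ ℓ ((p i)⁻¹ * x) = ℓ x - i := fun x => by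
    have : ∀ i, ∃ a, i ≤ ℓ x → ℓ a = i ∧ ℓ (a⁻¹ * x) = ℓ x - i := fun i => by
      by_cases hi : i ≤ ℓ x
      · obtain ⟨a, ha⟩ := h.exists_point_on_geodesic x hi
        exact ⟨a, fun _ => ha⟩
      · exact ⟨1, fun hi' => absurd hi' hi⟩
    choose p hp using this
    exact ⟨p, hp⟩
  choose p hp using hpre
  let X : {g // ℓ g = n + K} × {g // ℓ g = m + K} → Γ := fun q => q.1.1 * f q.1.1 q.2.1 * q.2.1
  have hXlow : ∀ q, n + m + K ≤ ℓ (X q) := fun q => by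
    have h1 : _ ≤ ℓ (X q) + K := hf q.1.1 q.2.1
    have h2 := q.1.2
    have h3 := q.2.2
    omega
  have hXup : ∀ q, ℓ ((q.1.1)⁻¹ * X q) ≤ m + K + R := fun q => by
    have h1 := h.mul_le (f q.1.1 q.2.1) q.2.1
    have h2 := hfR q.1.1 q.2.1
    have h3 := q.2.2
    have : (q.1.1)⁻¹ * X q = f q.1.1 q.2.1 * q.2.1 := by simp only [X]; group
    rw [this]
    omega
  have b1 : ∀ q, ℓ ((p (X q) (n + m + K))⁻¹ * X q) ≤ K + R := fun q => by
    have h1 := (hp (X q) _ (hXlow q)).2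
    have h2 := h.le_add_dist q.1.1 (X q)
    have h3 := hXup q
    have h4 := q.1.2
    omega
  have b2 : ∀ q, ℓ ((p (X q) (n + K))⁻¹ * q.1.1) ≤ K + R + D := fun q => by
    have h1 := hXlow q
    obtain ⟨h2, h3⟩ := hp (X q) (n + K) (by omega)
    have h4 := hXup q
    have h5 := q.1.2
    have := h.gromov_trans (x := p (X q) (n + K)) (z := X q) (y := q.1.1) (t := 2 * (n + K))
      (e := K + R) (by omega) (by rw [h.dist_comm]; omega)
    omega
  rw [← Nat.card_prod, ← Nat.card_prod, ← Nat.card_prod, ← Nat.card_prod]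
  refine Nat.card_le_card_of_injective
    (fun q => (⟨⟨_, (hp (X q) _ (hXlow q)).1⟩, ⟨_, b1 q⟩, ⟨_, hfR q.1.1 q.2.1⟩, ⟨_, b2 q⟩⟩ :
      {g // ℓ g = n + m + K} × {g // ℓ g ≤ K + R} × {g // ℓ g ≤ R} × {g // ℓ g ≤ K + R + D}))
    fun q q' hqq => ?_
  simp only [Prod.mk.injEq, Subtype.mk.injEq] at hqq
  obtain ⟨h1, h2, h3, h4⟩ := hqq
  rw [h1] at h2
  have hX : X q = X q' := mul_left_cancel h2
  rw [hX] at h4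
  have hq1 : q.1.1 = q'.1.1 := mul_left_cancel h4
  have hq2 : q.2.1 = q'.2.1 := by
    simp only [X] at hX
    rw [h3, hq1] at hX
    exact mul_left_cancel hX
  exact Prod.ext (Subtype.ext hq1) (Subtype.ext hq2)

theorem card_ball_le_of_card_sphere_le (h : IsHyperbolicLength ℓ D) {C : ℕ}
    (hC : ∀ n, Nat.card {g // ℓ g = n} ≤ C) (n : ℕ) :
    Nat.card {g // ℓ g ≤ n} ≤ C * (n + 1) := by
  have := h.finite_sphere
  calc Nat.card {g // ℓ g ≤ n}
      ≤ Nat.card (Σ i : Fin (n + 1), {g // ℓ g = i}) :=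
        Nat.card_le_card_of_injective
          (fun g => (⟨⟨ℓ g.1, Nat.lt_succ_iff.2 g.2⟩, ⟨g.1, rfl⟩⟩ :
            Σ i : Fin (n + 1), {g // ℓ g = i}))
          fun a b hab => by
            have := congrArg (fun t : Σ i : Fin (n + 1), {g // ℓ g = i} => t.2.1) hab
            exact Subtype.ext this
    _ = ∑ i : Fin (n + 1), Nat.card {g // ℓ g = i} := Nat.card_sigma
    _ ≤ ∑ _i : Fin (n + 1), C := Finset.sum_le_sum fun i _ => hC i
    _ = C * (n + 1) := by simp [mul_comm]

theorem not_linear_growth (h : IsHyperbolicLength ℓ D) [Infinite Γ]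
    (hne : ¬ ∃ H : Subgroup Γ, H.FiniteIndex ∧ IsCyclic H) :
    ¬ ∃ C, ∀ n, Nat.card {g // ℓ g ≤ n} ≤ C * (n + 1) := by
  rintro ⟨C, hC⟩
  obtain ⟨b, hb0, hb⟩ := h.exists_length_pow
  refine hne ⟨Subgroup.zpowers b, h.finiteIndex_zpowers (fun m n hmn => ?_) hC, inferInstance⟩
  have := congrArg ℓ hmn
  simp only [hb] at this
  exact Nat.eq_of_mul_eq_mul_right hb0 this

theorem exists_bounded_cancellation (h : IsHyperbolicLength ℓ D) [Infinite Γ]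
    (hne : ¬ ∃ H : Subgroup Γ, H.FiniteIndex ∧ IsCyclic H) :
    ∃ R K, ∀ g k, ∃ f, ℓ f ≤ R ∧ ℓ g + ℓ k ≤ ℓ (g * f * k) + K := by
  by_contra! hc
  refine h.not_linear_growth hne ⟨(D + 2) * Nat.card {f // ℓ f ≤ 3 * D}, fun R => ?_⟩
  obtain ⟨g, k, hgk⟩ := hc R (7 * R + 5 * D + 2)
  refine (h.card_ball_le_of_cancellation hgk).trans ?_
  rw [mul_right_comm]
  exact Nat.mul_le_mul_right _ (by nlinarith)

end IsHyperbolicLength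

/-- A sequence that is submultiplicative, and supermultiplicative up to a shift and a constant, is
purely exponential. -/
theorem exists_exp_bounds {s : ℕ → ℕ} (hpos : ∀ n, 0 < s n) (hsub : ∀ n m, s (n + m) ≤ s n * s m)
    {K A : ℕ} (hsup : ∀ n m, s (n + K) * s (m + K) ≤ s (n + m + K) * A) :
    ∃ v C : ℝ, 0 ≤ v ∧ 0 < C ∧ ∀ n : ℕ,
      C⁻¹ * Real.exp (v * n) ≤ s n ∧ (s n : ℝ) ≤ C * Real.exp (v * n) := by
  have hs : ∀ n, (0 : ℝ) < s n := fun n => by exact_mod_cast hpos n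
  have hu0 : ∀ n, 0 ≤ Real.log (s n) := fun n => Real.log_natCast_nonneg _
  have hA : 0 < A := by
    have := (Nat.mul_pos (hpos (0 + K)) (hpos (0 + K))).trans_le (hsup 0 0)
    exact Nat.pos_of_mul_pos_left this
  have hA' : (0 : ℝ) < A := by exact_mod_cast hA
  have hu : Subadditive fun n => Real.log (s n) := fun m n => by
    rw [← Real.log_mul (hs m).ne' (hs n).ne']
    exact Real.log_le_log (hs _) (by exact_mod_cast hsub m n)
  have hubdd : BddBelow (Set.range fun n : ℕ => Real.log (s n) / n) :=
    ⟨0, by rintro _ ⟨n, rfl⟩; exact div_nonneg (hu0 n) n.cast_nonneg⟩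
  have hw : Subadditive fun n => Real.log A - Real.log (s (n + K)) := fun m n => by
    have := Real.log_le_log (mul_pos (hs _) (hs _))
      (show (s (m + K) : ℝ) * s (n + K) ≤ s (m + n + K) * A by exact_mod_cast hsup m n)
    rw [Real.log_mul (hs _).ne' (hs _).ne', Real.log_mul (hs _).ne' hA'.ne'] at this
    linarith
  have hlim := hu.tendsto_lim hubdd
  have hv0 : 0 ≤ hu.lim := ge_of_tendsto' hlim fun n => div_nonneg (hu0 n) n.cast_nonneg
  have hvle : ∀ n : ℕ, hu.lim * n ≤ Real.log (s n) := fun n => by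
    rcases Nat.eq_zero_or_pos n with rfl | hn
    · simpa using hu0 0
    · have := hu.lim_le_div hubdd hn.ne'
      rwa [le_div_iff₀ (by exact_mod_cast hn)] at this
  have hwlow : ∀ n : ℕ, -(Real.log (s n) / n) + (Real.log A - Real.log (s K)) / n ≤
      (Real.log A - Real.log (s (n + K))) / n := fun n => by
    have h1 : Real.log (s (n + K)) ≤ Real.log (s n) + Real.log (s K) := hu n K
    rw [← neg_div, ← add_div]
    exact div_le_div_of_nonneg_right (by linarith) n.cast_nonneg
  have hlow : Filter.Tendsto
      (fun n : ℕ => -(Real.log (s n) / n) + (Real.log A - Real.log (s K)) / n) Filter.atTop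
      (nhds (-hu.lim + 0)) :=
    hlim.neg.add (tendsto_const_div_atTop_nhds_zero_nat _)
  have hwbdd : BddBelow (Set.range fun n : ℕ => (Real.log A - Real.log (s (n + K))) / n) := by
    obtain ⟨B, hB⟩ := hlow.bddBelow_range
    refine ⟨B, ?_⟩
    rintro _ ⟨n, rfl⟩
    exact (hB ⟨n, rfl⟩).trans (hwlow n)
  have hwlim : -hu.lim ≤ hw.lim := by
    have := le_of_tendsto_of_tendsto' hlow (hw.tendsto_lim hwbdd) hwlow
    linarith
  have hup : ∀ n : ℕ, Real.log (s (n + K)) ≤ Real.log A + Real.log (s K) + hu.lim * n := fun n => by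
    rcases Nat.eq_zero_or_pos n with rfl | hn
    · have : 0 ≤ Real.log A := Real.log_natCast_nonneg _
      simp only [zero_add, Nat.cast_zero, mul_zero, add_zero]
      linarith
    · have h1 := hw.lim_le_div hwbdd hn.ne'
      have hn' : (0 : ℝ) < n := by exact_mod_cast hn
      rw [le_div_iff₀ hn'] at h1
      have h2 := mul_le_mul_of_nonneg_right hwlim hn'.le
      have h3 := hu0 K
      linarith
  set B : ℝ := Real.log A + Real.log (s K) + ∑ i ∈ Finset.range K, Real.log (s i) with hBdef
  have hsum : 0 ≤ ∑ i ∈ Finset.range K, Real.log (s i) := Finset.sum_nonneg fun i _ => hu0 i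
  have hB0 : 0 ≤ B := by
    have h1 : 0 ≤ Real.log A := Real.log_natCast_nonneg _
    have h2 := hu0 K
    linarith
  refine ⟨hu.lim, Real.exp B, hv0, Real.exp_pos _, fun n => ⟨?_, ?_⟩⟩
  · rw [← Real.exp_neg, ← Real.exp_add, ← Real.le_log_iff_exp_le (hs n)]
    linarith [hvle n]
  · rw [← Real.exp_add, ← Real.log_le_iff_le_exp (hs n)]
    rcases lt_or_ge n K with hn | hn
    · have h1 := Finset.single_le_sum (fun i _ => hu0 i) (Finset.mem_range.2 hn)
      have h2 : 0 ≤ hu.lim * n := mul_nonneg hv0 n.cast_nonneg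
      have h3 : 0 ≤ Real.log A := Real.log_natCast_nonneg _
      have h4 := hu0 K
      linarith
    · obtain ⟨m, rfl⟩ := Nat.exists_eq_add_of_le' hn
      have h1 := hup m
      have h2 : hu.lim * m ≤ hu.lim * (m + K : ℕ) :=
        mul_le_mul_of_nonneg_left (by push_cast; linarith [K.cast_nonneg (α := ℝ)]) hv0
      linarith

theorem IsHyperbolicLength.exists_exp_bounds {Γ : Type} [Group Γ] [Infinite Γ] {ℓ : Γ → ℕ} {D : ℕ}
    (h : IsHyperbolicLength ℓ D) (hne : ¬ ∃ H : Subgroup Γ, H.FiniteIndex ∧ IsCyclic H) :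
    ∃ v C : ℝ, 0 < v ∧ 0 < C ∧ ∀ n : ℕ,
      C⁻¹ * Real.exp (v * n) ≤ (Nat.card {g // ℓ g = n} : ℝ) ∧
      (Nat.card {g // ℓ g = n} : ℝ) ≤ C * Real.exp (v * n) := by
  obtain ⟨R, K, hRK⟩ := h.exists_bounded_cancellation hne
  obtain ⟨v, C, hv, hC, hb⟩ := _root_.exists_exp_bounds h.card_sphere_pos h.card_sphere_add_le
    (h.card_sphere_mul_le hRK)
  refine ⟨v, C, lt_of_le_of_ne hv ?_, hC, hb⟩
  rintro rfl
  refine h.not_linear_growth hne ⟨⌈C⌉₊, h.card_ball_le_of_card_sphere_le fun n => ?_⟩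
  have h1 := (hb n).2
  rw [zero_mul, Real.exp_zero, mul_one] at h1
  exact_mod_cast h1.trans (Nat.le_ceil C)

section WordLength

variable {Γ : Type} [Group Γ] {S : Set Γ}

theorem wordLength_prod_le {l : List Γ} (hl : ∀ x ∈ l, x ∈ S) : wordLength S l.prod ≤ l.length :=
  Nat.sInf_le ⟨l, hl, rfl, rfl⟩

theorem exists_list_length_eq_wordLength (hsym : ∀ s ∈ S, s⁻¹ ∈ S)
    (hgen : Subgroup.closure S = ⊤) (g : Γ) :
    ∃ l : List Γ, (∀ x ∈ l, x ∈ S) ∧ l.length = wordLength S g ∧ l.prod = g := by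
  have hmem : g ∈ (Subgroup.closure S).toSubmonoid := by simp [hgen]
  rw [Subgroup.closure_toSubmonoid] at hmem
  obtain ⟨l, hl, hg⟩ := Submonoid.exists_list_of_mem_closure hmem
  refine Nat.sInf_mem (s := {n | ∃ l : List Γ, (∀ x ∈ l, x ∈ S) ∧ l.length = n ∧ l.prod = g})
    ⟨l.length, l, fun x hx => (hl x hx).elim id fun h => ?_, rfl, hg⟩
  simpa using hsym _ (Set.mem_inv.1 h)

theorem wordLength_mul_le (hsym : ∀ s ∈ S, s⁻¹ ∈ S) (hgen : Subgroup.closure S = ⊤) (g h : Γ) :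
    wordLength S (g * h) ≤ wordLength S g + wordLength S h := by
  obtain ⟨l, hl, hlen, rfl⟩ := exists_list_length_eq_wordLength hsym hgen g
  obtain ⟨l', hl', hlen', rfl⟩ := exists_list_length_eq_wordLength hsym hgen h
  rw [← hlen, ← hlen', ← List.prod_append, ← List.length_append]
  exact wordLength_prod_le fun x hx => (List.mem_append.1 hx).elim (hl x) (hl' x)

theorem wordLength_inv_le (hsym : ∀ s ∈ S, s⁻¹ ∈ S) (hgen : Subgroup.closure S = ⊤) (g : Γ) :
    wordLength S g⁻¹ ≤ wordLength S g := by
  obtain ⟨l, hl, hlen, rfl⟩ := exists_list_length_eq_wordLength hsym hgen g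
  rw [← hlen, List.prod_inv_reverse]
  refine (wordLength_prod_le fun x hx => ?_).trans (by simp)
  simp only [List.mem_reverse, List.mem_map] at hx
  obtain ⟨y, hy, rfl⟩ := hx
  exact hsym y (hl y hy)

theorem wordLength_one : wordLength S 1 = 0 :=
  Nat.le_zero.1 (wordLength_prod_le (l := []) (by simp))

theorem wordLength_exists_geodesic (hsym : ∀ s ∈ S, s⁻¹ ∈ S) (hgen : Subgroup.closure S = ⊤)
    (g : Γ) : ∃ p : ℕ → Γ, p 0 = 1 ∧ p (wordLength S g) = g ∧
      ∀ i j, i ≤ j → j ≤ wordLength S g → wordLength S ((p i)⁻¹ * p j) = j - i := by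
  obtain ⟨l, hl, hlen, hg⟩ := exists_list_length_eq_wordLength hsym hgen g
  refine ⟨fun i => (l.take i).prod, by simp, by simp [← hlen, hg], fun i j hij hj => ?_⟩
  set m := ((l.take j).drop i) with hm
  have hmid : (l.take i).prod * m.prod = (l.take j).prod := by
    rw [hm, ← List.prod_append]
    congr 1
    conv_rhs => rw [← List.take_append_drop i (l.take j), List.take_take, min_eq_left hij]
  have heq : (l.take i).prod⁻¹ * (l.take j).prod = m.prod := by rw [← hmid, inv_mul_cancel_left]
  have hmS : wordLength S m.prod ≤ j - i := by
    refine (wordLength_prod_le fun x hx => hl x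
      (List.mem_of_mem_take (List.mem_of_mem_drop hx))).trans ?_
    rw [List.length_drop, List.length_take]
    omega
  have h1 : wordLength S (l.take i).prod ≤ i :=
    (wordLength_prod_le fun x hx => hl x (List.mem_of_mem_take hx)).trans
      (by rw [List.length_take]; omega)
  have h2 : wordLength S (l.drop j).prod ≤ wordLength S g - j :=
    (wordLength_prod_le fun x hx => hl x (List.mem_of_mem_drop hx)).trans
      (by rw [List.length_drop]; omega)
  have hprod : (l.take i).prod * m.prod * (l.drop j).prod = g := by
    rw [hmid, ← List.prod_append, List.take_append_drop, hg]
  have h3 := wordLength_mul_le hsym hgen ((l.take i).prod * m.prod) (l.drop j).prod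
  have h4 := wordLength_mul_le hsym hgen (l.take i).prod m.prod
  rw [hprod] at h3
  simp only [heq]
  omega

theorem finite_wordLength_le (hS : S.Finite) (hsym : ∀ s ∈ S, s⁻¹ ∈ S)
    (hgen : Subgroup.closure S = ⊤) (n : ℕ) : Finite {g // wordLength S g ≤ n} := by
  have := hS.to_subtype
  refine ((List.finite_length_le S n).image fun l => (l.map Subtype.val).prod).subset ?_
  intro g hg
  obtain ⟨l, hl, hlen, hprod⟩ := exists_list_length_eq_wordLength hsym hgen g
  lift l to List S using hl
  refine ⟨l, ?_, hprod⟩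
  rw [List.length_map] at hlen
  exact hlen.trans_le hg

theorem isHyperbolicLength_wordLength (hS : S.Finite) (hsym : ∀ s ∈ S, s⁻¹ ∈ S)
    (hgen : Subgroup.closure S = ⊤) {D : ℕ}
    (hD : ∀ x y z w : Γ, wordLength S (x⁻¹ * y) + wordLength S (z⁻¹ * w) ≤
      max (wordLength S (x⁻¹ * z) + wordLength S (y⁻¹ * w))
        (wordLength S (y⁻¹ * z) + wordLength S (x⁻¹ * w)) + D) :
    IsHyperbolicLength (wordLength S) D where
  one := wordLength_one
  eq_one g hg := by
    obtain ⟨l, -, hlen, rfl⟩ := exists_list_length_eq_wordLength hsym hgen g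
    rw [hg, List.length_eq_zero_iff] at hlen
    simp [hlen]
  inv g := le_antisymm (wordLength_inv_le hsym hgen g)
    (by simpa using wordLength_inv_le hsym hgen g⁻¹)
  mul_le := wordLength_mul_le hsym hgen
  finite_ball := finite_wordLength_le hS hsym hgen
  exists_geodesic := wordLength_exists_geodesic hsym hgen
  four_point := hD

end WordLength

theorem stmt_18
    {Γ : Type} [Group Γ] (S : Finset Γ)
    (hsym : ∀ s ∈ S, s⁻¹ ∈ S)
    (hgen : Subgroup.closure (S : Set Γ) = ⊤)
    (hinfinite : Infinite Γ)
    (hhyp : ∃ δ : ℝ, 0 ≤ δ ∧ ∀ x y z w : Γ,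
      (((wordLength (S : Set Γ) (x⁻¹ * w) : ℝ) + (wordLength (S : Set Γ) (y⁻¹ * w) : ℝ)
          - (wordLength (S : Set Γ) (x⁻¹ * y) : ℝ)) / 2 ≥
        min (((wordLength (S : Set Γ) (x⁻¹ * w) : ℝ) + (wordLength (S : Set Γ) (z⁻¹ * w) : ℝ)
              - (wordLength (S : Set Γ) (x⁻¹ * z) : ℝ)) / 2)
            (((wordLength (S : Set Γ) (y⁻¹ * w) : ℝ) + (wordLength (S : Set Γ) (z⁻¹ * w) : ℝ)
              - (wordLength (S : Set Γ) (y⁻¹ * z) : ℝ)) / 2) - δ))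
    (hnonelem : ¬ ∃ H : Subgroup Γ, H.FiniteIndex ∧ IsCyclic H) :
    ∃ v C : ℝ, 0 < v ∧ 0 < C ∧ ∀ n : ℕ,
      C⁻¹ * Real.exp (v * n) ≤ (Nat.card {g : Γ // wordLength (S : Set Γ) g = n} : ℝ) ∧
      (Nat.card {g : Γ // wordLength (S : Set Γ) g = n} : ℝ) ≤ C * Real.exp (v * n) := by
  obtain ⟨δ, -, hδ⟩ := hhyp
  refine (isHyperbolicLength_wordLength S.finite_toSet hsym hgen (D := 2 * ⌈δ⌉₊)
    fun x y z w => ?_).exists_exp_bounds hnonelem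
  have h1 := hδ x y z w
  have h2 := Nat.le_ceil δ
  rw [ge_iff_le, sub_le_iff_le_add, min_le_iff] at h1
  rw [← Nat.cast_le (α := ℝ)]
  push_cast
  rw [← sub_le_iff_le_add, le_max_iff]
  rcases h1 with h1 | h1
  · left; linarith
  · right; linarith
end

section
/- Let Γ be a countable group with a proper left-invariant metric d, and suppose there exist constants v > 0 and C_0 > 0 such that C_0^{-1} e^{v r} ≤ |B(e,r)| ≤ C_0 e^{v r} for all r > 0, where B(e,r) = {g ∈ Γ : d(e,g) ≤ r}. Then there exist constants a > 0 and C_1 > 0 such that for every s > v and every γ ∈ Γ, the Poincaré series Z_s(γ) := Σ_{g ∈ Γ} e^{−s d(γ,g)} converges and satisfies C_1^{-1} (1 − e^{a(v−s)})^{-1} ≤ Z_s(γ) ≤ C_1 (1 − e^{a(v−s)})^{-1}. -/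
open MeasureTheory Set

theorem lintegral_exp_neg_mul_Ioi {t : ℝ} (ht : 0 < t) (c : ℝ) :
    ∫⁻ r in Ioi c, ENNReal.ofReal (Real.exp (-(t * r))) =
      ENNReal.ofReal (Real.exp (-(t * c)) / t) := by
  have ht' : -t < 0 := neg_neg_of_pos ht
  have h := ofReal_integral_eq_lintegral_ofReal (integrableOn_exp_mul_Ioi ht' c)
    (Filter.Eventually.of_forall fun r => (Real.exp_pos _).le)
  rw [integral_exp_mul_Ioi ht', neg_div_neg_eq] at h
  simpa only [neg_mul] using h.symm

/-- The layer-cake formula for the Laplace transform of a counting function. -/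
theorem tsum_ofReal_exp_neg_mul_eq_lintegral {ι : Type*} [Countable ι] {f : ι → ℝ}
    (hf : ∀ i, 0 ≤ f i) {s : ℝ} (hs : 0 < s) :
    ∑' i, ENNReal.ofReal (Real.exp (-(s * f i))) =
      ∫⁻ r in Ioi (0 : ℝ), ({i | f i ≤ r}.encard : ENNReal) *
        ENNReal.ofReal (s * Real.exp (-(s * r))) := by
  have hterm (i : ι) : ENNReal.ofReal (Real.exp (-(s * f i))) =
      ∫⁻ r in Ioi (0 : ℝ),
        (Ici (f i)).indicator (fun r => ENNReal.ofReal (s * Real.exp (-(s * r)))) r := by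
    rw [setLIntegral_congr Ioi_ae_eq_Ici, setLIntegral_indicator measurableSet_Ici,
      inter_eq_left.2 (Ici_subset_Ici.2 (hf i)), ← setLIntegral_congr Ioi_ae_eq_Ici]
    simp_rw [ENNReal.ofReal_mul hs.le]
    rw [lintegral_const_mul _ (by fun_prop), lintegral_exp_neg_mul_Ioi hs,
      ← ENNReal.ofReal_mul hs.le, mul_div_cancel₀ _ hs.ne']
  simp_rw [hterm]
  rw [← lintegral_tsum fun i =>
    ((by fun_prop : Measurable fun r : ℝ => ENNReal.ofReal (s * Real.exp (-(s * r)))).indicator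
      measurableSet_Ici).aemeasurable]
  refine lintegral_congr fun r => ?_
  rw [← ENNReal.tsum_set_const, tsum_subtype {i | f i ≤ r}
    fun _ => ENNReal.ofReal (s * Real.exp (-(s * r)))]
  rfl

theorem lintegral_exp_growth {v s C : ℝ} (hs : 0 < s) (hvs : v < s) (hC : 0 ≤ C) :
    ∫⁻ r in Ioi (0 : ℝ), ENNReal.ofReal (C * Real.exp (v * r)) *
        ENNReal.ofReal (s * Real.exp (-(s * r))) =
      ENNReal.ofReal (C * (s / (s - v))) := by
  have hexp (r : ℝ) : ENNReal.ofReal (C * Real.exp (v * r)) *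
      ENNReal.ofReal (s * Real.exp (-(s * r))) =
      ENNReal.ofReal (C * s) * ENNReal.ofReal (Real.exp (-((s - v) * r))) := by
    rw [← ENNReal.ofReal_mul (by positivity), ← ENNReal.ofReal_mul (by positivity),
      mul_mul_mul_comm, ← Real.exp_add]
    ring_nf
  simp_rw [hexp]
  rw [lintegral_const_mul _ (by fun_prop), lintegral_exp_neg_mul_Ioi (sub_pos.2 hvs),
    ← ENNReal.ofReal_mul (by positivity)]
  simp only [mul_zero, neg_zero, Real.exp_zero]
  ring_nf

theorem summable_exp_neg_mul_of_exp_growth {ι : Type*} [Countable ι] {f : ι → ℝ}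
    (hf : ∀ i, 0 ≤ f i) (hfin : ∀ r, {i | f i ≤ r}.Finite) {v s A B : ℝ} (hs : 0 < s)
    (hvs : v < s) (hA : 0 ≤ A) (hB : 0 ≤ B)
    (hlow : ∀ r, 0 < r → A * Real.exp (v * r) ≤ {i | f i ≤ r}.ncard)
    (hupp : ∀ r, 0 < r → {i | f i ≤ r}.ncard ≤ B * Real.exp (v * r)) :
    Summable (fun i => Real.exp (-(s * f i))) ∧
      A * (s / (s - v)) ≤ ∑' i, Real.exp (-(s * f i)) ∧
      ∑' i, Real.exp (-(s * f i)) ≤ B * (s / (s - v)) := by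
  have hsv : 0 < s - v := sub_pos.2 hvs
  have hcard (r : ℝ) : ({i | f i ≤ r}.encard : ENNReal) =
      ENNReal.ofReal ({i | f i ≤ r}.ncard : ℝ) := by
    rw [← (hfin r).cast_ncard_eq]
    simp
  have hle : ∑' i, ENNReal.ofReal (Real.exp (-(s * f i))) ≤
      ENNReal.ofReal (B * (s / (s - v))) := by
    rw [tsum_ofReal_exp_neg_mul_eq_lintegral hf hs, ← lintegral_exp_growth hs hvs hB]
    refine setLIntegral_mono' measurableSet_Ioi fun r hr => ?_
    rw [hcard]
    gcongr
    exact hupp r hr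
  have hge : ENNReal.ofReal (A * (s / (s - v))) ≤
      ∑' i, ENNReal.ofReal (Real.exp (-(s * f i))) := by
    rw [tsum_ofReal_exp_neg_mul_eq_lintegral hf hs, ← lintegral_exp_growth hs hvs hA]
    refine setLIntegral_mono' measurableSet_Ioi fun r hr => ?_
    rw [hcard]
    gcongr
    exact hlow r hr
  have hsum : Summable fun i => Real.exp (-(s * f i)) := by
    simpa only [ENNReal.toReal_ofReal (Real.exp_pos _).le] using
      ENNReal.summable_toReal (ne_top_of_le_ne_top ENNReal.ofReal_ne_top hle)
  rw [← ENNReal.ofReal_tsum_of_nonneg (fun i => (Real.exp_pos _).le) hsum] at hle hge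
  exact ⟨hsum, (ENNReal.ofReal_le_ofReal_iff (tsum_nonneg fun i => (Real.exp_pos _).le)).1 hge,
    (ENNReal.ofReal_le_ofReal_iff (by positivity)).1 hle⟩

theorem inv_one_sub_exp_neg_le {x : ℝ} (hx : 0 < x) :
    (1 - Real.exp (-x))⁻¹ ≤ (1 + x) / x := by
  rw [← inv_div]
  refine inv_anti₀ (by positivity) ?_
  have h : Real.exp (-x) ≤ (1 + x)⁻¹ := by
    rw [Real.exp_neg]
    exact inv_anti₀ (by positivity) (by linarith [Real.add_one_le_exp x])
  have h' : x / (1 + x) = 1 - (1 + x)⁻¹ := by field_simp; ring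
  linarith

theorem le_two_mul_inv_one_sub_exp_neg {x : ℝ} (hx : 0 < x) :
    (1 + x) / x ≤ 2 * (1 - Real.exp (-x))⁻¹ := by
  have hpos : 0 < 1 - Real.exp (-x) := sub_pos.2 (Real.exp_lt_one_iff.2 (by linarith))
  rw [← div_eq_mul_inv, div_le_div_iff₀ hx hpos]
  rcases le_total x 1 with h | h
  · nlinarith [Real.add_one_le_exp (-x)]
  · nlinarith [Real.exp_pos (-x)]


theorem stmt_19
    {Γ : Type} [Group Γ] [Countable Γ] (d : Γ → Γ → ℝ)
    (hzero : ∀ x y : Γ, d x y = 0 ↔ x = y)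
    (hsymm : ∀ x y : Γ, d x y = d y x)
    (htri : ∀ x y z : Γ, d x z ≤ d x y + d y z)
    (hinv : ∀ g x y : Γ, d (g * x) (g * y) = d x y)
    (hproper : ∀ R : ℝ, {g : Γ | d 1 g ≤ R}.Finite)
    (v C₀ : ℝ) (hv : 0 < v) (hC₀ : 0 < C₀)
    -- C₀⁻¹ e^{vr} ≤ |B(e,r)| ≤ C₀ e^{vr} for all r > 0
    (hgrowth : ∀ r : ℝ, 0 < r →
      C₀⁻¹ * Real.exp (v * r) ≤ (Nat.card {g : Γ // d 1 g ≤ r} : ℝ) ∧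
      (Nat.card {g : Γ // d 1 g ≤ r} : ℝ) ≤ C₀ * Real.exp (v * r)) :
    ∃ a C₁ : ℝ, 0 < a ∧ 0 < C₁ ∧ ∀ s : ℝ, v < s → ∀ γ : Γ,
      Summable (fun g : Γ => Real.exp (-(s * d γ g))) ∧
      C₁⁻¹ * (1 - Real.exp (a * (v - s)))⁻¹ ≤ ∑' g : Γ, Real.exp (-(s * d γ g)) ∧
      ∑' g : Γ, Real.exp (-(s * d γ g)) ≤ C₁ * (1 - Real.exp (a * (v - s)))⁻¹ := by
  have hnonneg (g : Γ) : 0 ≤ d 1 g := by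
    have := htri 1 g 1
    rw [hsymm g 1, (hzero 1 1).2 rfl] at this
    linarith
  refine ⟨v⁻¹, 2 * C₀, by positivity, by positivity, fun s hvs γ => ?_⟩
  have hs : 0 < s := hv.trans hvs
  have hx : 0 < (s - v) / v := div_pos (sub_pos.2 hvs) hv
  have hratio : s / (s - v) = (1 + (s - v) / v) / ((s - v) / v) := by
    have := (sub_pos.2 hvs).ne'
    field_simp
    ring
  have harg : v⁻¹ * (v - s) = -((s - v) / v) := by
    field_simp
    ring
  have htrans : (fun g : Γ => Real.exp (-(s * d γ g))) =
      (fun g => Real.exp (-(s * d 1 g))) ∘ Equiv.mulLeft γ⁻¹ := by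
    ext g
    simp [← hinv γ⁻¹ γ g]
  obtain ⟨hsum, hlow, hupp⟩ := summable_exp_neg_mul_of_exp_growth hnonneg hproper hs hvs
    (inv_nonneg.2 hC₀.le) hC₀.le (fun r hr => (hgrowth r hr).1) (fun r hr => (hgrowth r hr).2)
  have htsum : ∑' g : Γ, Real.exp (-(s * d γ g)) = ∑' g : Γ, Real.exp (-(s * d 1 g)) := by
    rw [htrans]
    exact (Equiv.mulLeft γ⁻¹).tsum_eq fun g => Real.exp (-(s * d 1 g))
  have hlower := inv_one_sub_exp_neg_le hx
  have hupper := le_two_mul_inv_one_sub_exp_neg hx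
  rw [← hratio] at hlower hupper
  rw [htsum, harg]
  refine ⟨htrans ▸ (Equiv.mulLeft γ⁻¹).summable_iff.2 hsum, ?_, ?_⟩
  · refine le_trans ?_ hlow
    gcongr
    · exact (inv_pos.2 (sub_pos.2 (Real.exp_lt_one_iff.2 (by linarith)))).le
    · linarith
  · calc _ ≤ C₀ * (s / (s - v)) := hupp
      _ ≤ C₀ * (2 * (1 - Real.exp (-((s - v) / v)))⁻¹) := by gcongr
      _ = _ := by ring
end
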